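/- There exists M > 0 (depending only on d, h and p) such that every u ∈ ℝ^d with u_k ≥ 0 for all k ∈ {1,…,d−1} and u_d ≥ M belongs to D_e; that is, the maximal solution of system (1.1) starting from any such u blows up in finite time. -/

import Mathlib

open scoped BigOperators
open Filter Topology Set

/-- The `n`-th coordinate (0-based) of a vector in `ℝ^d`, with junk value `0` out of range. -/
noncomputable def coordFn {d : ℕ} (u : Fin d → ℝ) (n : ℕ) : ℝ :=
  if hn : n < d then u ⟨n, hn⟩ else 0

/-- The vector field `b` of system (1.1) (0-based indices: coordinate `1 ≤ k ≤ d` of the paper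
is coordinate `k - 1` here). -/
noncomputable def bField (d : ℕ) (h p : ℝ) (u : Fin d → ℝ) (i : Fin d) : ℝ :=
  if (i : ℕ) = 0 then (2 / h ^ 2) * (-coordFn u 0 + coordFn u 1)
  else if (i : ℕ) = d - 1 then
    (2 / h ^ 2) * (-coordFn u (d - 1) + coordFn u (d - 2)
      + h * ((max (coordFn u (d - 1)) 0) ^ p - coordFn u (d - 1)))
  else (1 / h ^ 2) * (coordFn u ((i : ℕ) + 1) - 2 * coordFn u (i : ℕ) + coordFn u ((i : ℕ) - 1))

/-- The Euclidean norm on `ℝ^d`. -/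
noncomputable def euclNorm {d : ℕ} (u : Fin d → ℝ) : ℝ := Real.sqrt (∑ i, (u i) ^ 2)

/-- `u` belongs to the domain of explosion `D_e`: the (unique, maximal) solution of (1.1)
starting at `u` blows up in finite time, i.e. there are `τ < ∞` and a solution `U` of (1.1)
on `[0, τ)` with `U(0) = u` and `|U(t)| → ∞` as `t → τ⁻`. -/
def BlowsUp (d : ℕ) (h p : ℝ) (u : Fin d → ℝ) : Prop :=
  ∃ (τ : ℝ) (U : ℝ → Fin d → ℝ), 0 < τ ∧ U 0 = u ∧
    (∀ t ∈ Set.Ico 0 τ, HasDerivWithinAt U (bField d h p (U t)) (Set.Ico 0 τ) t) ∧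
    Filter.Tendsto (fun t => euclNorm (U t)) (nhdsWithin τ (Set.Iio τ)) Filter.atTop

/-- The (unique, maximal) solution of (1.1) starting at `u` is global and converges to `L`
as `t → ∞`. -/
def GlobalTo (d : ℕ) (h p : ℝ) (u L : Fin d → ℝ) : Prop :=
  ∃ U : ℝ → Fin d → ℝ, U 0 = u ∧
    (∀ t : ℝ, 0 ≤ t → HasDerivWithinAt U (bField d h p (U t)) (Set.Ici 0) t) ∧
    Filter.Tendsto U Filter.atTop (nhds L)

/-- Truncation of every coordinate to the interval `[0, R]`. -/
noncomputable def clampBox {d : ℕ} (R : ℝ) (u : Fin d → ℝ) : Fin d → ℝ :=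
  fun i => max 0 (min (u i) R)

lemma coordFn_of_lt {d : ℕ} (u : Fin d → ℝ) {n : ℕ} (hn : n < d) : coordFn u n = u ⟨n, hn⟩ :=
  dif_pos hn

lemma coordFn_mem_Icc {d : ℕ} {R : ℝ} (hR : 0 ≤ R) {u : Fin d → ℝ}
    (hu : u ∈ Icc 0 (fun _ => R)) (n : ℕ) : coordFn u n ∈ Icc 0 R := by
  unfold coordFn
  split_ifs with hn
  · exact ⟨hu.1 _, hu.2 _⟩
  · exact ⟨le_rfl, hR⟩

lemma contDiff_coordFn {d : ℕ} (n : ℕ) : ContDiff ℝ 1 (fun u : Fin d → ℝ => coordFn u n) := by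
  unfold coordFn
  split_ifs with hn
  · exact contDiff_apply ℝ ℝ _
  · exact contDiff_const

lemma clampBox_mem {d : ℕ} {R : ℝ} (hR : 0 ≤ R) (u : Fin d → ℝ) :
    clampBox R u ∈ Icc 0 (fun _ => R) :=
  ⟨fun _ => le_max_left _ _, fun _ => max_le hR (min_le_right _ _)⟩

lemma clampBox_of_mem {d : ℕ} {R : ℝ} {u : Fin d → ℝ} (hu : u ∈ Icc 0 (fun _ => R)) :
    clampBox R u = u := by
  funext i
  have h₁ : 0 ≤ u i := hu.1 i
  have h₂ : u i ≤ R := hu.2 i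
  simp [clampBox, h₁, h₂]

lemma lipschitzWith_clampBox {d : ℕ} (R : ℝ) :
    LipschitzWith 1 (clampBox R : (Fin d → ℝ) → Fin d → ℝ) :=
  LipschitzWith.of_dist_le_mul fun u v => by
    rw [NNReal.coe_one, one_mul, dist_pi_le_iff dist_nonneg]
    intro i
    have := ((LipschitzWith.id.min_const R).const_max 0).dist_le_mul (u i) (v i)
    rw [NNReal.coe_one, one_mul] at this
    exact this.trans (dist_le_pi_dist u v i)

lemma contDiffOn_bField {d : ℕ} {h p : ℝ} (hp : 1 < p) {R : ℝ} (hR : 0 ≤ R) :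
    ContDiffOn ℝ 1 (bField d h p) (Icc 0 (fun _ => R)) := by
  have hc : ∀ n : ℕ, ContDiffOn ℝ 1 (fun u : Fin d → ℝ => coordFn u n) (Icc 0 (fun _ => R)) :=
    fun n => (contDiff_coordFn n).contDiffOn
  have hpow : ContDiff ℝ 1 (fun x : ℝ => x ^ p) := by
    exact_mod_cast Real.contDiff_rpow_const_of_le (n := 1) (p := p) (by simpa using hp.le)
  rw [contDiffOn_pi]
  intro i
  unfold bField
  split_ifs
  · exact contDiffOn_const.mul ((hc _).neg.add (hc _))
  · refine contDiffOn_const.mul (((hc _).neg.add (hc _)).add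
      (contDiffOn_const.mul (ContDiffOn.sub ?_ (hc _))))
    refine (hpow.comp_contDiffOn (hc (d - 1))).congr fun u hu => ?_
    simp only [Function.comp, max_eq_left (coordFn_mem_Icc hR hu (d - 1)).1]
  · exact contDiffOn_const.mul (((hc _).sub (contDiffOn_const.mul (hc _))).add (hc _))

lemma exists_lipschitzOnWith_bField (d : ℕ) (h : ℝ) {p : ℝ} (hp : 1 < p) {R : ℝ} (hR : 0 ≤ R) :
    ∃ K, LipschitzOnWith K (bField d h p) (Icc 0 (fun _ => R)) :=
  (contDiffOn_bField hp hR).exists_lipschitzOnWith one_ne_zero (convex_Icc _ _) isCompact_Icc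

lemma bField_nonneg_of_eq_zero {d : ℕ} {h p R : ℝ} (hR : 0 ≤ R) {u : Fin d → ℝ}
    (hu : u ∈ Icc 0 (fun _ => R)) {i : Fin d} (hi : (i : ℕ) < d - 1) (h0 : u i = 0) :
    0 ≤ bField d h p u i := by
  have hc := fun n => (coordFn_mem_Icc hR hu n).1
  have hi0 : coordFn u i = 0 := by rw [coordFn_of_lt u i.2, Fin.eta, h0]
  unfold bField
  rw [if_neg hi.ne]
  split_ifs with hz
  · rw [hz] at hi0
    rw [hi0]
    have : 0 ≤ 2 / h ^ 2 := by positivity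
    exact mul_nonneg this (by linarith [hc 1])
  · rw [hi0]
    have : 0 ≤ 1 / h ^ 2 := by positivity
    exact mul_nonneg this (by linarith [hc (i + 1), hc (i - 1)])

lemma bField_nonpos_of_eq {d : ℕ} {h p R : ℝ} (hR : 0 ≤ R) {u : Fin d → ℝ}
    (hu : u ∈ Icc 0 (fun _ => R)) {i : Fin d} (hi : (i : ℕ) < d - 1) (h0 : u i = R) :
    bField d h p u i ≤ 0 := by
  have hc := fun n => (coordFn_mem_Icc hR hu n).2
  have hi0 : coordFn u i = R := by rw [coordFn_of_lt u i.2, Fin.eta, h0]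
  unfold bField
  rw [if_neg hi.ne]
  split_ifs with hz
  · rw [hz] at hi0
    rw [hi0]
    have : 0 ≤ 2 / h ^ 2 := by positivity
    exact mul_nonpos_of_nonneg_of_nonpos this (by linarith [hc 1])
  · rw [hi0]
    have : 0 ≤ 1 / h ^ 2 := by positivity
    exact mul_nonpos_of_nonneg_of_nonpos this (by linarith [hc (i + 1), hc (i - 1)])

lemma rpow_div_le_bField_last {d : ℕ} (hd : 2 ≤ d) {h p R : ℝ} (hh : 0 < h) (hR : 0 ≤ R)
    {u : Fin d → ℝ} (hu : u ∈ Icc 0 (fun _ => R)) {l : Fin d} (hl : (l : ℕ) = d - 1)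
    (hpos : 0 < u l) (hbig : 2 * (1 + h) / h ≤ u l ^ (p - 1)) :
    u l ^ p / h ≤ bField d h p u l := by
  have hl0 : coordFn u (d - 1) = u l := by rw [← hl, coordFn_of_lt u l.2]
  have hc := (coordFn_mem_Icc hR hu (d - 2)).1
  unfold bField
  rw [if_neg (by omega), if_pos hl, hl0, max_eq_left hpos.le]
  have hpow : u l ^ p = u l ^ (p - 1) * u l := by
    rw [← Real.rpow_add_one hpos.ne']; simp
  have h1 : 2 * (1 + h) * u l ≤ h * u l ^ p := by
    rw [hpow]
    rw [div_le_iff₀ hh] at hbig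
    nlinarith
  have h2 : u l ^ p / h = (2 / h ^ 2) * (h * u l ^ p / 2) := by field_simp
  rw [h2]
  exact mul_le_mul_of_nonneg_left (by linarith) (by positivity)

/-- A globally Lipschitz and bounded autonomous field has solutions on every `[0, T]`. -/
lemma exists_solution_of_lipschitz_bounded {E : Type*} [NormedAddCommGroup E] [NormedSpace ℝ E]
    [CompleteSpace E] {f : E → E} {K : NNReal} (hf : LipschitzWith K f) {C : ℝ}
    (hC : ∀ x, ‖f x‖ ≤ C) {T : ℝ} (hT : 0 ≤ T) (x : E) :
    ∃ α : ℝ → E, α 0 = x ∧ ∀ t ∈ Icc 0 T, HasDerivWithinAt α (f (α t)) (Icc 0 T) t := by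
  have hC0 : 0 ≤ C := (norm_nonneg _).trans (hC x)
  have : IsPicardLindelof (fun _ => f) (⟨0, le_rfl, hT⟩ : Icc 0 T) x
      (⟨C * T, mul_nonneg hC0 hT⟩ : NNReal) 0 ⟨C, hC0⟩ K :=
    { lipschitzOnWith := fun _ _ => hf.lipschitzOnWith
      continuousOn := fun _ _ => continuousOn_const
      norm_le := fun _ _ y _ => hC y
      mul_max_le := by simp [hT]; exact le_rfl }
  exact this.exists_eq_forall_mem_Icc_hasDerivWithinAt₀

lemma HasDerivWithinAt.Ici_of_Icc {E : Type*} [NormedAddCommGroup E] [NormedSpace ℝ E]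
    {f : ℝ → E} {f' : E} {a b t : ℝ} (hf : HasDerivWithinAt f f' (Icc a b) t)
    (ht : t ∈ Ico a b) : HasDerivWithinAt f f' (Ici t) t :=
  hf.mono_of_mem_nhdsWithin (mem_of_superset (Icc_mem_nhdsGE ht.2) (Icc_subset_Icc_left ht.1))

/-- A differentiable function which does not increase while above `c` stays below `c`. -/
lemma image_le_of_deriv_nonpos_above {y y' : ℝ → ℝ} {T c : ℝ}
    (hy : ∀ t ∈ Icc 0 T, HasDerivWithinAt y (y' t) (Icc 0 T) t) (h0 : y 0 ≤ c)
    (hy' : ∀ t ∈ Icc 0 T, c ≤ y t → y' t ≤ 0) {t : ℝ} (ht : t ∈ Icc 0 T) : y t ≤ c := by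
  have key : ∀ ε > 0, y t ≤ c + ε * t := by
    intro ε hε
    refine image_le_of_deriv_right_lt_deriv_boundary' (B := fun s => c + ε * s)
      (B' := fun _ => ε) (fun s hs => (hy s hs).continuousWithinAt)
      (fun s hs => (hy s (Ico_subset_Icc_self hs)).Ici_of_Icc hs) (by simpa using h0)
      (by fun_prop) (fun s _ => ?_) (fun s hs hs' => ?_) ht
    · simpa using (((hasDerivAt_id s).const_mul ε).const_add c).hasDerivWithinAt
    · refine (hy' s (Ico_subset_Icc_self hs) ?_).trans_lt hε
      rw [hs']
      have := mul_nonneg hε.le hs.1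
      linarith
  have hlim : Tendsto (fun ε : ℝ => c + ε * t) (𝓝[>] 0) (𝓝 c) := by
    have : Continuous fun ε : ℝ => c + ε * t := by fun_prop
    simpa using (this.tendsto 0).mono_left nhdsWithin_le_nhds
  exact ge_of_tendsto hlim (eventually_nhdsWithin_of_forall key)

/-- A differentiable function which does not decrease while below `c` stays above `c`. -/
lemma le_image_of_deriv_nonneg_below {y y' : ℝ → ℝ} {T c : ℝ}
    (hy : ∀ t ∈ Icc 0 T, HasDerivWithinAt y (y' t) (Icc 0 T) t) (h0 : c ≤ y 0)
    (hy' : ∀ t ∈ Icc 0 T, y t ≤ c → 0 ≤ y' t) {t : ℝ} (ht : t ∈ Icc 0 T) : c ≤ y t := by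
  have := image_le_of_deriv_nonpos_above (y := fun t => -y t) (y' := fun t => -y' t) (c := -c)
    (fun s hs => (hy s hs).neg) (neg_le_neg h0)
    (fun s hs hs' => neg_nonpos.2 (hy' s hs (neg_le_neg_iff.1 hs'))) ht
  exact neg_le_neg_iff.1 this

/-- Superlinear growth `y' ≥ y ^ p / h` starting above `M` cannot persist up to time
`h * M ^ (1 - p) / (p - 1)`. -/
lemma false_of_superlinear_growth {y y' : ℝ → ℝ} {h p M : ℝ} (hh : 0 < h) (hp : 1 < p)
    (hM : 0 < M)
    (hy : ∀ t ∈ Icc 0 (h * M ^ (1 - p) / (p - 1)),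
      HasDerivWithinAt y (y' t) (Icc 0 (h * M ^ (1 - p) / (p - 1))) t)
    (hyM : ∀ t ∈ Icc 0 (h * M ^ (1 - p) / (p - 1)), M ≤ y t)
    (hy' : ∀ t ∈ Icc 0 (h * M ^ (1 - p) / (p - 1)), y t ^ p / h ≤ y' t) : False := by
  set T := h * M ^ (1 - p) / (p - 1) with hT
  have hp1 : 0 < p - 1 := sub_pos.2 hp
  have hT0 : 0 ≤ T := by positivity
  have hz : ∀ t ∈ Icc 0 T, HasDerivWithinAt (fun t => y t ^ (1 - p) + (p - 1) / h * t)
      (y' t * (1 - p) * y t ^ (1 - p - 1) + (p - 1) / h) (Icc 0 T) t := fun t ht => by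
    have hpos : y t ≠ 0 := (hM.trans_le (hyM t ht)).ne'
    have hlin : HasDerivWithinAt (fun t : ℝ => (p - 1) / h * t) ((p - 1) / h) (Icc 0 T) t := by
      simpa using (hasDerivWithinAt_id t _).const_mul ((p - 1) / h)
    exact ((hy t ht).rpow_const (p := 1 - p) (Or.inl hpos)).add hlin
  have hanti : AntitoneOn (fun t => y t ^ (1 - p) + (p - 1) / h * t) (Icc 0 T) := by
    refine antitoneOn_of_hasDerivWithinAt_nonpos (convex_Icc _ _)
      (fun t ht => (hz t ht).continuousWithinAt)
      (fun t ht => (hz t (interior_subset ht)).mono interior_subset) fun t ht => ?_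
    have ht' := interior_subset ht
    have hpos : 0 < y t := hM.trans_le (hyM t ht')
    have hmul : y t ^ p * y t ^ (1 - p - 1) = 1 := by
      rw [← Real.rpow_add hpos]; simp
    have h1 : 1 / h ≤ y' t * y t ^ (1 - p - 1) := by
      have := mul_le_mul_of_nonneg_right (hy' t ht') (Real.rpow_nonneg hpos.le (1 - p - 1))
      rwa [div_mul_eq_mul_div, hmul] at this
    have h2 := mul_le_mul_of_nonneg_left h1 hp1.le
    have h3 : (p - 1) * (1 / h) = (p - 1) / h := by ring
    nlinarith
  have hend := hanti ⟨le_rfl, hT0⟩ ⟨hT0, le_rfl⟩ hT0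
  have hTT : (p - 1) / h * T = M ^ (1 - p) := by rw [hT]; field_simp
  simp only [mul_zero, add_zero, hTT] at hend
  have h0 : y 0 ^ (1 - p) ≤ M ^ (1 - p) :=
    Real.rpow_le_rpow_of_nonpos hM (hyM 0 ⟨le_rfl, hT0⟩) (by linarith)
  have hpos := Real.rpow_pos_of_pos (hM.trans_le (hyM T ⟨hT0, le_rfl⟩)) (1 - p)
  linarith

/-- Above a level `M` beyond which the reaction dominates, for every `R` exceeding the initial
data there is a solution that remains in `[0, R]^d` until its last coordinate, which is
nondecreasing, reaches `R`, and this happens within a time independent of `R`. -/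
lemma exists_solution_last_eq {d : ℕ} (hd : 2 ≤ d) {h p M : ℝ} (hh : 0 < h) (hp : 1 < p)
    (hM : 0 < M) (hbig : ∀ x, M ≤ x → 2 * (1 + h) / h ≤ x ^ (p - 1)) {l : Fin d}
    (hl : (l : ℕ) = d - 1) {u : Fin d → ℝ} (hu : 0 ≤ u) (huM : M ≤ u l) {R : ℝ}
    (hR : ∀ i, u i < R) :
    ∃ (τ : ℝ) (V : ℝ → Fin d → ℝ), 0 < τ ∧ τ ≤ h * M ^ (1 - p) / (p - 1) ∧ V 0 = u ∧
      (∀ t ∈ Icc 0 τ, HasDerivWithinAt V (bField d h p (V t)) (Icc 0 τ) t) ∧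
      (∀ t ∈ Icc 0 τ, V t ∈ Icc 0 (fun _ => R)) ∧
      MonotoneOn (fun t => V t l) (Icc 0 τ) ∧ V τ l = R := by
  have hMR : M < R := huM.trans_lt (hR l)
  have hR0 : 0 ≤ R := (hM.trans hMR).le
  set T := h * M ^ (1 - p) / (p - 1) with hT
  have hT0 : 0 ≤ T := by
    have := sub_pos.2 hp
    positivity
  obtain ⟨K, hK⟩ := exists_lipschitzOnWith_bField d h hp hR0
  have hlip : LipschitzWith (K * 1) (fun v => bField d h p (clampBox R v)) :=
    lipschitzOnWith_univ.1 <| hK.comp (lipschitzWith_clampBox R).lipschitzOnWith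
      fun v _ => clampBox_mem hR0 v
  obtain ⟨C, hC⟩ :=
    (isCompact_Icc (a := (0 : Fin d → ℝ)) (b := fun _ => R)).exists_bound_of_continuousOn
      hK.continuousOn
  obtain ⟨V, hV0, hV⟩ := exists_solution_of_lipschitz_bounded hlip
    (fun v => hC _ (clampBox_mem hR0 v)) hT0 u
  have hVi : ∀ i, ∀ t ∈ Icc 0 T, HasDerivWithinAt (fun t => V t i)
      (bField d h p (clampBox R (V t)) i) (Icc 0 T) t :=
    fun i t ht => hasDerivWithinAt_pi.1 (hV t ht) i
  have hbox : ∀ i : Fin d, (i : ℕ) < d - 1 → ∀ t ∈ Icc 0 T, V t i ∈ Icc 0 R := by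
    refine fun i hi t ht => ⟨?_, ?_⟩
    · refine le_image_of_deriv_nonneg_below (hVi i) (by rw [hV0]; exact hu i)
        (fun s hs hs' => ?_) ht
      refine bField_nonneg_of_eq_zero hR0 (clampBox_mem hR0 _) hi ?_
      exact max_eq_left ((min_le_left _ _).trans hs')
    · refine image_le_of_deriv_nonpos_above (hVi i) (by rw [hV0]; exact (hR i).le)
        (fun s hs hs' => ?_) ht
      refine bField_nonpos_of_eq hR0 (clampBox_mem hR0 _) hi ?_
      simp [clampBox, hs', hR0]
  have hgrow : ∀ t, M ≤ clampBox R (V t) l →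
      clampBox R (V t) l ^ p / h ≤ bField d h p (clampBox R (V t)) l := fun t ht =>
    rpow_div_le_bField_last hd hh hR0 (clampBox_mem hR0 _) hl (hM.trans_le ht) (hbig _ ht)
  have hcM : ∀ t, M ≤ V t l → M ≤ clampBox R (V t) l := fun t ht =>
    le_max_of_le_right (le_min ht hMR.le)
  have hlM : ∀ t ∈ Icc 0 T, M ≤ V t l := by
    intro t ht
    have := image_le_of_deriv_right_lt_deriv_boundary' (f := fun t => -V t l)
      (B := fun _ => -M) (B' := fun _ => 0)
      (fun s hs => (hVi l s hs).neg.continuousWithinAt)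
      (fun s hs => (hVi l s (Ico_subset_Icc_self hs)).neg.Ici_of_Icc hs)
      (by simpa [hV0] using huM) continuousOn_const
      (fun s _ => hasDerivWithinAt_const _ _ _)
      (fun s hs hs' => ?_) ht
    · exact neg_le_neg_iff.1 this
    · have hle := hcM s (neg_inj.1 hs').ge
      have : 0 < clampBox R (V s) l ^ p / h :=
        div_pos (Real.rpow_pos_of_pos (hM.trans_le hle) _) hh
      exact neg_neg_of_pos (this.trans_le (hgrow s hle))
  have hmono : MonotoneOn (fun t => V t l) (Icc 0 T) := by
    refine monotoneOn_of_hasDerivWithinAt_nonneg (convex_Icc _ _)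
      (fun t ht => (hVi l t ht).continuousWithinAt)
      (fun t ht => (hVi l t (interior_subset ht)).mono interior_subset) fun t ht => ?_
    have hle := hcM t (hlM t (interior_subset ht))
    exact (div_nonneg (Real.rpow_nonneg (hM.trans_le hle).le _) hh.le).trans (hgrow t hle)
  have hreach : R ≤ V T l := by
    by_contra! hlt
    refine false_of_superlinear_growth hh hp hM (hVi l) hlM fun t ht => ?_
    have hle : V t l ≤ R := (hmono ht ⟨hT0, le_rfl⟩ ht.2).trans hlt.le
    have heq : clampBox R (V t) l = V t l := by
      simp [clampBox, hle, hM.le.trans (hlM t ht)]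
    simpa [heq] using hgrow t (hcM t (hlM t ht))
  obtain ⟨τ, hτ, hτR⟩ : ∃ τ ∈ Icc 0 T, V τ l = R :=
    intermediate_value_Icc hT0 (fun t ht => (hVi l t ht).continuousWithinAt)
      ⟨by simpa [hV0] using (hR l).le, hreach⟩
  have hsub : Icc 0 τ ⊆ Icc 0 T := Icc_subset_Icc_right hτ.2
  have hVbox : ∀ t ∈ Icc 0 τ, V t ∈ Icc 0 (fun _ => R) := by
    intro t ht
    have hmem : ∀ i, V t i ∈ Icc 0 R := by
      intro i
      rcases (Nat.le_sub_one_of_lt i.2).lt_or_eq with hi | hi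
      · exact hbox i hi t (hsub ht)
      · obtain rfl : i = l := Fin.ext (hi.trans hl.symm)
        exact ⟨hM.le.trans (hlM t (hsub ht)), hτR ▸ hmono (hsub ht) hτ ht.2⟩
    exact ⟨fun i => (hmem i).1, fun i => (hmem i).2⟩
  refine ⟨τ, V, hτ.1.lt_of_ne ?_, hτ.2, hV0, fun t ht => ?_, hVbox, hmono.mono hsub, hτR⟩
  · rintro rfl
    rw [hV0] at hτR
    exact (hR l).ne hτR
  · simpa only [clampBox_of_mem (hVbox t ht)] using (hV t (hsub ht)).mono hsub

/-- Two solutions with the same initial value which stay in a box coincide. -/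
lemma eqOn_of_solutions {d : ℕ} {h p : ℝ} (hp : 1 < p) {R : ℝ} (hR : 0 ≤ R) {T : ℝ}
    {V W : ℝ → Fin d → ℝ} (h0 : V 0 = W 0)
    (hV : ∀ t ∈ Icc 0 T, HasDerivWithinAt V (bField d h p (V t)) (Icc 0 T) t)
    (hW : ∀ t ∈ Icc 0 T, HasDerivWithinAt W (bField d h p (W t)) (Icc 0 T) t)
    (hVR : ∀ t ∈ Icc 0 T, V t ∈ Icc 0 (fun _ => R))
    (hWR : ∀ t ∈ Icc 0 T, W t ∈ Icc 0 (fun _ => R)) : EqOn V W (Icc 0 T) := by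
  obtain ⟨K, hK⟩ := exists_lipschitzOnWith_bField d h hp hR
  exact ODE_solution_unique_of_mem_Icc_right (v := fun _ => bField d h p) (fun _ _ => hK)
    (fun t ht => (hV t ht).continuousWithinAt)
    (fun t ht => (hV t (Ico_subset_Icc_self ht)).Ici_of_Icc ht)
    (fun t ht => hVR t (Ico_subset_Icc_self ht))
    (fun t ht => (hW t ht).continuousWithinAt)
    (fun t ht => (hW t (Ico_subset_Icc_self ht)).Ici_of_Icc ht)
    (fun t ht => hWR t (Ico_subset_Icc_self ht)) h0

lemma apply_le_euclNorm {d : ℕ} (u : Fin d → ℝ) (i : Fin d) : u i ≤ euclNorm u :=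
  Real.le_sqrt_of_sq_le <|
    Finset.single_le_sum (f := fun i => u i ^ 2) (fun _ _ => sq_nonneg _) (Finset.mem_univ i)

lemma blowsUp_of_le {d : ℕ} (hd : 2 ≤ d) {h p M : ℝ} (hh : 0 < h) (hp : 1 < p)
    (hM : 0 < M) (hbig : ∀ x, M ≤ x → 2 * (1 + h) / h ≤ x ^ (p - 1)) {l : Fin d}
    (hl : (l : ℕ) = d - 1) {u : Fin d → ℝ} (hu : 0 ≤ u) (huM : M ≤ u l) :
    BlowsUp d h p u := by
  have hR : ∀ (n : ℕ) i, u i < ‖u‖ + 1 + n := fun n i => by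
    have h1 : u i ≤ ‖u‖ := (le_abs_self _).trans (norm_le_pi_norm u i)
    have h2 : (0 : ℝ) ≤ n := n.cast_nonneg
    linarith
  choose τ V hτ0 hτT hV0 hV hVR hmono hVτ using fun n =>
    exists_solution_last_eq hd hh hp hM hbig hl hu huM (hR n)
  have hagree : ∀ m n t, 0 ≤ t → t ≤ τ m → t ≤ τ n → V m t = V n t := by
    intro m n t ht hm hn
    have hbox : ∀ k ≤ max m n, t ≤ τ k → ∀ s ∈ Icc 0 t,
        V k s ∈ Icc 0 (fun _ => ‖u‖ + 1 + (max m n : ℕ)) := fun k hk hkt s hs => by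
      have := hVR k s ⟨hs.1, hs.2.trans hkt⟩
      refine ⟨this.1, this.2.trans fun _ => ?_⟩
      have : (k : ℝ) ≤ (max m n : ℕ) := by exact_mod_cast hk
      simpa using this
    have hsol : ∀ k, t ≤ τ k → ∀ s ∈ Icc 0 t,
        HasDerivWithinAt (V k) (bField d h p (V k s)) (Icc 0 t) s := fun k hk s hs =>
      (hV k s ⟨hs.1, hs.2.trans hk⟩).mono (Icc_subset_Icc_right hk)
    exact eqOn_of_solutions hp (by positivity) ((hV0 m).trans (hV0 n).symm) (hsol m hm)
      (hsol n hn) (hbox m (le_max_left _ _) hm) (hbox n (le_max_right _ _) hn) ⟨ht, le_rfl⟩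
  have hlt : ∀ n, τ n < τ (n + 1) := by
    intro n
    by_contra! hle
    have h1 := hagree n (n + 1) _ (hτ0 _).le hle le_rfl
    have h2 : V n (τ (n + 1)) l ≤ ‖u‖ + 1 + n := (hVR n _ ⟨(hτ0 _).le, hle⟩).2 l
    rw [h1, hVτ] at h2
    push_cast at h2
    linarith
  have hbdd : BddAbove (range τ) := ⟨_, forall_mem_range.2 hτT⟩
  have hsup : ∀ n, τ n < ⨆ k, τ k := fun n => (hlt n).trans_le (le_ciSup hbdd _)
  have hex : ∀ t, t < ⨆ k, τ k → ∃ n, t < τ n := fun t ht => exists_lt_of_lt_ciSup ht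
  classical
  let U : ℝ → Fin d → ℝ := fun t => if ht : ∃ n, t < τ n then V ht.choose t else u
  have hU : ∀ n t, 0 ≤ t → t ≤ τ n → U t = V n t := by
    intro n t ht0 htn
    have ht : ∃ n, t < τ n := hex t (htn.trans_lt (hsup n))
    simp only [U, dif_pos ht]
    exact hagree _ _ _ ht0 ht.choose_spec.le htn
  refine ⟨⨆ k, τ k, U, (hτ0 0).trans (hsup 0), ?_, fun t ht => ?_, ?_⟩
  · rw [hU 0 0 le_rfl (hτ0 0).le, hV0]
  · obtain ⟨n, hn⟩ := hex t ht.2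
    rw [hU n t ht.1 hn.le]
    have hcongr : HasDerivWithinAt U (bField d h p (V n t)) (Icc 0 (τ n)) t :=
      (hV n t ⟨ht.1, hn.le⟩).congr (fun s hs => hU n s hs.1 hs.2) (hU n t ht.1 hn.le)
    refine hcongr.mono_of_mem_nhdsWithin ?_
    filter_upwards [self_mem_nhdsWithin, nhdsWithin_le_nhds (Iio_mem_nhds hn)] with s hs hs'
    exact ⟨hs.1, (mem_Iio.1 hs').le⟩
  · refine tendsto_atTop.2 fun b => ?_
    obtain ⟨n, hn⟩ := exists_nat_ge b
    filter_upwards [Ioo_mem_nhdsLT (hsup n)] with t ht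
    obtain ⟨m, hm⟩ := hex t ht.2
    have ht0 : 0 ≤ t := (hτ0 n).le.trans ht.1.le
    have hle : U (τ n) l ≤ U t l := by
      rw [hU m t ht0 hm.le, hU m (τ n) (hτ0 n).le (ht.1.trans hm).le]
      exact hmono m ⟨(hτ0 n).le, (ht.1.trans hm).le⟩ ⟨ht0, hm.le⟩ ht.1.le
    rw [hU n (τ n) (hτ0 n).le le_rfl, hVτ] at hle
    linarith [apply_le_euclNorm (U t) l, norm_nonneg u]

/-- there is `M > 0` (depending only on `d`, `h`, `p`) such that every `u` with
nonnegative first `d - 1` coordinates and last coordinate at least `M` lies in `D_e`. -/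
theorem stmt13 (d : ℕ) (hd : 2 ≤ d) (h p : ℝ) (hh : 0 < h) (hp : 1 < p) :
    ∃ M : ℝ, 0 < M ∧ ∀ u : Fin d → ℝ,
      (∀ i : Fin d, (i : ℕ) < d - 1 → 0 ≤ u i) → M ≤ coordFn u (d - 1) →
      BlowsUp d h p u := by
  obtain ⟨M₀, hM₀⟩ := eventually_atTop.1
    ((tendsto_rpow_atTop (sub_pos.2 hp)).eventually_ge_atTop (2 * (1 + h) / h))
  refine ⟨max M₀ 1, by positivity, fun u hu huM => ?_⟩
  have hlast : d - 1 < d := by omega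
  rw [coordFn_of_lt u hlast] at huM
  have hpos : (0 : ℝ) < max M₀ 1 := by positivity
  refine blowsUp_of_le hd hh hp hpos (fun x hx => hM₀ x ((le_max_left _ _).trans hx))
    (l := ⟨d - 1, hlast⟩) rfl (fun i => ?_) huM
  rcases (Nat.le_sub_one_of_lt i.2).lt_or_eq with hi | hi
  · exact hu i hi
  · obtain rfl : i = ⟨d - 1, hlast⟩ := Fin.ext hi
    exact hpos.le.trans huM
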